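/- Under the two-group random mixture model, fix α,β∈[0,1] with β ≥ mFNR*(α). Then for every ε > 0, the Neyman–Pearson rule δ^n_NP(α) satisfies P(FDP(δ^n_NP(α)) ≤ α + ε) → 1 and P(FNP(δ^n_NP(α)) ≤ β + ε) → 1 as n→∞. -/

import Mathlib

open MeasureTheory ProbabilityTheory Filter

namespace TwoGroup

/-- The two-group random mixture model: a σ-finite base measure on the sample space `𝒳`,
a null proportion `π0 ∈ (0,1)`, and null/non-null probability density functions `f0`, `f1`
with respect to the base measure. -/
structure Model (𝒳 : Type*) [MeasurableSpace 𝒳] where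
  base : Measure 𝒳
  sigmaFinite : SigmaFinite base
  π0 : ℝ
  π0_mem : π0 ∈ Set.Ioo (0 : ℝ) 1
  f0 : 𝒳 → ℝ
  f1 : 𝒳 → ℝ
  f0_meas : Measurable f0
  f1_meas : Measurable f1
  f0_nonneg : ∀ x, 0 ≤ f0 x
  f1_nonneg : ∀ x, 0 ≤ f1 x
  f0_prob : IsProbabilityMeasure (base.withDensity fun x => ENNReal.ofReal (f0 x))
  f1_prob : IsProbabilityMeasure (base.withDensity fun x => ENNReal.ofReal (f1 x))

namespace Model

variable {𝒳 : Type*} [MeasurableSpace 𝒳] (M : Model 𝒳)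

/-- The non-null proportion `π1 = 1 - π0`. -/
noncomputable def π1 : ℝ := 1 - M.π0

/-- The marginal density `f = π0 f0 + π1 f1`. -/
noncomputable def f (x : 𝒳) : ℝ := M.π0 * M.f0 x + M.π1 * M.f1 x

/-- The local false discovery rate `Lfdr(x) = π0 f0(x) / f(x)`. -/
noncomputable def Lfdr (x : 𝒳) : ℝ := M.π0 * M.f0 x / M.f x

/-- The joint law of a single pair `(θ, X)`; `true` encodes `θ = 1` (non-null). -/
noncomputable def joint : Measure (Bool × 𝒳) :=
  (ENNReal.ofReal M.π0) •
      ((Measure.dirac false).prod (M.base.withDensity fun x => ENNReal.ofReal (M.f0 x))) +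
    (ENNReal.ofReal M.π1) •
      ((Measure.dirac true).prod (M.base.withDensity fun x => ENNReal.ofReal (M.f1 x)))

/-- The joint law of `((θ1, X1), …, (θn, Xn))`: i.i.d. copies of `(θ, X)`. -/
noncomputable def jointN (n : ℕ) : Measure (Fin n → Bool × 𝒳) :=
  Measure.pi fun _ => M.joint

end Model

/-- Number of rejections `Σ_i δ_i`. -/
def nRej {n : ℕ} (d : Fin n → Bool) : ℝ := ∑ i, if d i then (1 : ℝ) else 0

/-- Number of false discoveries `Σ_i δ_i (1 - θ_i)`. -/
def nFD {n : ℕ} (θ d : Fin n → Bool) : ℝ :=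
  ∑ i, (if d i then (1 : ℝ) else 0) * (if θ i then (0 : ℝ) else 1)

/-- Number of acceptances `Σ_i (1 - δ_i)`. -/
def nAcc {n : ℕ} (d : Fin n → Bool) : ℝ := ∑ i, if d i then (0 : ℝ) else 1

/-- Number of false non-discoveries `Σ_i (1 - δ_i) θ_i`. -/
def nFN {n : ℕ} (θ d : Fin n → Bool) : ℝ :=
  ∑ i, (if d i then (0 : ℝ) else 1) * (if θ i then (1 : ℝ) else 0)

/-- False discovery proportion. -/
noncomputable def FDP {n : ℕ} (θ d : Fin n → Bool) : ℝ := nFD θ d / max 1 (nRej d)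

/-- False non-discovery proportion. -/
noncomputable def FNP {n : ℕ} (θ d : Fin n → Bool) : ℝ := nFN θ d / max 1 (nAcc d)

/-- A decision rule is a Markov kernel from `𝒳^n` to `{0,1}^n`: a measurable family of
probability measures on `Fin n → Bool`. -/
def IsRule {𝒳 : Type*} [MeasurableSpace 𝒳] {n : ℕ}
    (κ : (Fin n → 𝒳) → Measure (Fin n → Bool)) : Prop :=
  Measurable κ ∧ ∀ x, IsProbabilityMeasure (κ x)

namespace Model

variable {𝒳 : Type*} [MeasurableSpace 𝒳] (M : Model 𝒳)

/-- The false discovery rate `FDR = E[FDP]` of a (randomized) decision rule. -/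
noncomputable def FDR (n : ℕ) (κ : (Fin n → 𝒳) → Measure (Fin n → Bool)) : ℝ :=
  ∫ ω, ∫ d, FDP (fun i => (ω i).1) d ∂(κ fun i => (ω i).2) ∂(M.jointN n)

/-- The false non-discovery rate `FNR = E[FNP]` of a (randomized) decision rule. -/
noncomputable def FNR (n : ℕ) (κ : (Fin n → 𝒳) → Measure (Fin n → Bool)) : ℝ :=
  ∫ ω, ∫ d, FNP (fun i => (ω i).1) d ∂(κ fun i => (ω i).2) ∂(M.jointN n)

/-- The marginal FDR `mFDR = E[Σ δi (1-θi)] / E[Σ δi]` (with `0/0 = 0`). -/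
noncomputable def mFDR (n : ℕ) (κ : (Fin n → 𝒳) → Measure (Fin n → Bool)) : ℝ :=
  (∫ ω, ∫ d, nFD (fun i => (ω i).1) d ∂(κ fun i => (ω i).2) ∂(M.jointN n)) /
    (∫ ω, ∫ d, nRej d ∂(κ fun i => (ω i).2) ∂(M.jointN n))

/-- The marginal FNR `mFNR = E[Σ (1-δi) θi] / E[Σ (1-δi)]` (with `0/0 = 0`). -/
noncomputable def mFNR (n : ℕ) (κ : (Fin n → 𝒳) → Measure (Fin n → Bool)) : ℝ :=
  (∫ ω, ∫ d, nFN (fun i => (ω i).1) d ∂(κ fun i => (ω i).2) ∂(M.jointN n)) /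
    (∫ ω, ∫ d, nAcc d ∂(κ fun i => (ω i).2) ∂(M.jointN n))

/-- `FNR*_n(α)`: the minimum FNR over decision rules controlling FDR at level `α`. -/
noncomputable def FNRstar (n : ℕ) (α : ℝ) : ℝ :=
  sInf {r | ∃ κ : (Fin n → 𝒳) → Measure (Fin n → Bool),
    IsRule κ ∧ M.FDR n κ ≤ α ∧ r = M.FNR n κ}

/-- The minimum mFNR over decision rules for `n` hypotheses controlling mFDR at level `α`. -/
noncomputable def mFNRstarN (n : ℕ) (α : ℝ) : ℝ :=
  sInf {r | ∃ κ : (Fin n → 𝒳) → Measure (Fin n → Bool),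
    IsRule κ ∧ M.mFDR n κ ≤ α ∧ r = M.mFNR n κ}

/-- `mFNR*(α)` (this quantity does not depend on the number of hypotheses; we take `n = 1`). -/
noncomputable def mFNRstar (α : ℝ) : ℝ := M.mFNRstarN 1 α

/-- The marginal law of a single observation `X ∼ f`. -/
noncomputable def Pmix : Measure 𝒳 := M.base.withDensity fun x => ENNReal.ofReal (M.f x)

/-- The law of `W = Lfdr(X)`, `X ∼ f`. -/
noncomputable def νW : Measure ℝ := M.Pmix.map M.Lfdr

/-- `G(t) = P(W ≤ t)`. -/
noncomputable def G (t : ℝ) : ℝ := (M.νW (Set.Iic t)).toReal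

/-- `Ḡ(t) = P(W < t)`. -/
noncomputable def Gbar (t : ℝ) : ℝ := (M.νW (Set.Iio t)).toReal

/-- The generalized inverse `G^{-1}(u) = inf{t : G(t) ≥ u}`. -/
noncomputable def Ginv (u : ℝ) : ℝ := sInf {t | u ≤ M.G t}

/-- `P(W = t)`. -/
noncomputable def atom (t : ℝ) : ℝ := (M.νW {t}).toReal

/-- The randomization probability `p(u)`, satisfying
`Ḡ(G^{-1}(u)) + p(u) P(W = G^{-1}(u)) = u`. -/
noncomputable def pu (u : ℝ) : ℝ := (u - M.Gbar (M.Ginv u)) / M.atom (M.Ginv u)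

/-- `a(u) = E[W | S_u = 1]` for `u ∈ (0,1]`, `a(0) = 0`, where `S_u` is the Bernoulli(u)
thresholding variable of `W` at `G^{-1}(u)` with randomization `p(u)` at the boundary. -/
noncomputable def a (u : ℝ) : ℝ :=
  if u = 0 then 0
  else ((∫ w in Set.Iio (M.Ginv u), w ∂M.νW) + M.pu u * (M.Ginv u * M.atom (M.Ginv u))) / u

/-- `b(u) = E[1 - W | S_u = 0]` for `u ∈ [0,1)`, `b(1) = 0`. -/
noncomputable def b (u : ℝ) : ℝ :=
  if u = 1 then 0
  else ((∫ w in Set.Ioi (M.Ginv u), (1 - w) ∂M.νW)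
      + (1 - M.pu u) * ((1 - M.Ginv u) * M.atom (M.Ginv u))) / (1 - u)

/-- `b*(α) = inf{b(u) : u ∈ [0,1], a(u) ≤ α}`. -/
noncomputable def bstar (α : ℝ) : ℝ :=
  sInf {y | ∃ u ∈ Set.Icc (0 : ℝ) 1, M.a u ≤ α ∧ y = M.b u}

/-- `u*(α) = sup{u ∈ [0,1] : a(u) ≤ α}`. -/
noncomputable def ustar (α : ℝ) : ℝ :=
  sSup {u | u ∈ Set.Icc (0 : ℝ) 1 ∧ M.a u ≤ α}

/-- `b**(α) = inf{E[b(U)] : U a [0,1]-valued random variable with E[a(U)] ≤ α}`. -/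
noncomputable def bstarstar (α : ℝ) : ℝ :=
  sInf {y | ∃ ρ : Measure ℝ, IsProbabilityMeasure ρ ∧ (∀ᵐ u ∂ρ, u ∈ Set.Icc (0 : ℝ) 1) ∧
    (∫ u, M.a u ∂ρ) ≤ α ∧ y = ∫ u, M.b u ∂ρ}

end Model

/-- The Bernoulli(p) measure on `Bool`. -/
noncomputable def bern (p : ℝ) : Measure Bool :=
  (ENNReal.ofReal p) • Measure.dirac true + (ENNReal.ofReal (1 - p)) • Measure.dirac false

namespace Model

variable {𝒳 : Type*} [MeasurableSpace 𝒳] (M : Model 𝒳)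

/-- The per-observation rejection probability of the Neyman–Pearson rule at level `α`:
reject if `Lfdr(x) < G^{-1}(u*(α))`, randomize with probability `p(u*(α))` at equality,
and accept otherwise. -/
noncomputable def qNP (α : ℝ) (x : 𝒳) : ℝ :=
  if M.Lfdr x < M.Ginv (M.ustar α) then 1
  else if M.Lfdr x = M.Ginv (M.ustar α) then M.pu (M.ustar α)
  else 0

/-- The Neyman–Pearson rule `δ^n_NP(α)`, as a Markov kernel: independent randomized
likelihood-ratio tests applied to each observation. -/
noncomputable def NP (α : ℝ) (n : ℕ) : (Fin n → 𝒳) → Measure (Fin n → Bool) :=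
  fun x => Measure.pi fun i => bern (M.qNP α (x i))

/-- The probability (over data and the randomization of the rule `κ`) that the decision vector
lies in the set `E θ` (which may depend on the true labels `θ`). -/
noncomputable def prob (n : ℕ) (κ : (Fin n → 𝒳) → Measure (Fin n → Bool))
    (E : (Fin n → Bool) → Set (Fin n → Bool)) : ℝ :=
  (∫⁻ ω, κ (fun i => (ω i).2) (E fun i => (ω i).1) ∂(M.jointN n)).toReal

end Model

/-- `sortedVal n w i` is the `i`-th order statistic `w_(i)` (for `1 ≤ i ≤ n`) of
`w 0, …, w (n-1)`. -/
noncomputable def sortedVal (n : ℕ) (w : Fin n → ℝ) (i : ℕ) : ℝ :=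
  ((Multiset.map w Finset.univ.val).sort (· ≤ ·)).getD (i - 1) 0

/-- `avgLow n w k = (1/k) Σ_{i=1}^k w_(i)` (equal to `0` when `k = 0`). -/
noncomputable def avgLow (n : ℕ) (w : Fin n → ℝ) (k : ℕ) : ℝ :=
  (∑ i ∈ Finset.Icc 1 k, sortedVal n w i) / k

/-- `avgHigh n w k = (1/(n-k)) Σ_{i=k+1}^n (1 - w_(i))` (equal to `0` when `k = n`). -/
noncomputable def avgHigh (n : ℕ) (w : Fin n → ℝ) (k : ℕ) : ℝ :=
  (∑ i ∈ Finset.Icc (k + 1) n, (1 - sortedVal n w i)) / ((n : ℝ) - k)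

/-- The greatest convex minorant on `[0,1]` of a function `h`, evaluated at `α`. -/
noncomputable def gcm (h : ℝ → ℝ) (α : ℝ) : ℝ :=
  sSup {y | ∃ C : ℝ → ℝ, ConvexOn ℝ (Set.Icc 0 1) C ∧
    (∀ t ∈ Set.Icc (0 : ℝ) 1, C t ≤ h t) ∧ y = C α}

end TwoGroup

namespace TwoGroup

/-- If `0 ≤ F ≤ D ≤ 1` and `𝔼 F ≤ c 𝔼 D`, then for i.i.d. samples the ratio
`∑ F / max 1 (∑ D)` is at most `c + ε` with probability tending to one. -/
lemma tendsto_pi_sum_le {Z : Type*} [MeasurableSpace Z] (μ : Measure Z) [IsProbabilityMeasure μ]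
    {F D : Z → ℝ} (hF : Measurable F) (hD : Measurable D) (hF0 : ∀ z, 0 ≤ F z)
    (hFD : ∀ z, F z ≤ D z) (hD1 : ∀ z, D z ≤ 1) {c ε : ℝ} (hc : 0 ≤ c) (hε : 0 < ε)
    (h : ∫ z, F z ∂μ ≤ c * ∫ z, D z ∂μ) :
    Tendsto (fun n : ℕ => (Measure.pi fun _ : Fin n => μ).real
      {z | ∑ i, F (z i) ≤ (c + ε) * max 1 (∑ i, D (z i))}) atTop (nhds 1) := by
  have hD0 : ∀ z, 0 ≤ D z := fun z => (hF0 z).trans (hFD z)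
  have hFi : Integrable F μ := Integrable.of_bound hF.aestronglyMeasurable 1
    (ae_of_all _ fun z => by rw [Real.norm_of_nonneg (hF0 z)]; exact (hFD z).trans (hD1 z))
  have hDi : Integrable D μ := Integrable.of_bound hD.aestronglyMeasurable 1
    (ae_of_all _ fun z => by rw [Real.norm_of_nonneg (hD0 z)]; exact hD1 z)
  rcases (integral_nonneg hD0 : 0 ≤ ∫ z, D z ∂μ).eq_or_lt with h0 | hpos
  · have hD00 : D =ᵐ[μ] 0 := (integral_eq_zero_iff_of_nonneg hD0 hDi).1 h0.symm
    have key : ∀ n : ℕ, (Measure.pi fun _ : Fin n => μ).real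
        {z | ∑ i, F (z i) ≤ (c + ε) * max 1 (∑ i, D (z i))} = 1 := by
      intro n
      have hall : ∀ᵐ z ∂(Measure.pi fun _ : Fin n => μ), ∀ i, D (z i) = 0 := by
        rw [ae_all_iff]
        intro i
        exact (measurePreserving_eval (fun _ : Fin n => μ) i).quasiMeasurePreserving.ae hD00
      have : (Measure.pi fun _ : Fin n => μ)
          {z | ∑ i, F (z i) ≤ (c + ε) * max 1 (∑ i, D (z i))} = 1 := by
        rw [← mem_ae_iff_prob_eq_one
          (measurableSet_le (by fun_prop) (by fun_prop))]
        filter_upwards [hall] with z hz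
        have : ∑ i, F (z i) = 0 := Finset.sum_eq_zero fun i _ =>
          le_antisymm ((hFD _).trans (hz i).le) (hF0 _)
        simp only [this]
        positivity
      rw [measureReal_def, this, ENNReal.toReal_one]
    simp only [key, tendsto_const_nhds]
  · set Y : Z → ℝ := fun z => F z - (c + ε) * D z with hY
    have hYm : Measurable Y := by fun_prop
    set m : ℝ := ∫ z, Y z ∂μ with hm
    have hm_neg : m < 0 := by
      rw [hm, hY, integral_sub hFi (hDi.const_mul _), integral_const_mul]
      nlinarith
    have hY2 : MemLp Y 2 μ := memLp_of_bounded (a := -(c + ε)) (b := 1)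
      (ae_of_all _ fun z => ⟨by
        have := hF0 z; have := hD1 z; have := hD0 z
        simp only [hY]; nlinarith [mul_nonneg (add_nonneg hc hε.le) (sub_nonneg.2 (hD1 z))], by
        have := mul_nonneg (add_nonneg hc hε.le) (hD0 z)
        have := hFD z; have := hD1 z
        simp only [hY]; linarith⟩) hYm.aestronglyMeasurable 2
    set v := variance Y μ
    have lower : ∀ n : ℕ, 1 ≤ n → 1 - v / m ^ 2 / n ≤ (Measure.pi fun _ : Fin n => μ).real
        {z | ∑ i, F (z i) ≤ (c + ε) * max 1 (∑ i, D (z i))} := by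
      intro n hn
      have hn0 : (0 : ℝ) < n := by exact_mod_cast hn
      set P := Measure.pi fun _ : Fin n => μ
      set S : (Fin n → Z) → ℝ := ∑ i : Fin n, fun z : Fin n → Z => Y (z i) with hS
      have hSval : ∀ z, S z = ∑ i, Y (z i) := fun z => by simp [hS]
      have hmem : ∀ i : Fin n, MemLp (fun z : Fin n → Z => Y (z i)) 2 P := fun i =>
        hY2.comp_measurePreserving (measurePreserving_eval (fun _ : Fin n => μ) i)
      have hvar : variance S P = n * v := by
        have := variance_sum_pi (μ := fun _ : Fin n => μ) (X := fun _ => Y) fun _ => hY2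
        simpa using this
      have hmean : ∫ z, S z ∂P = n * m := by
        simp only [hSval]
        rw [integral_finsetSum _ fun i _ => (hmem i).integrable (by norm_num)]
        have : ∀ i : Fin n, ∫ z, Y (z i) ∂P = m := fun i =>
          integral_comp_eval (μ := fun _ : Fin n => μ) hYm.aestronglyMeasurable
        simp [this]
      have hSmem : MemLp S 2 P := memLp_finsetSum' _ fun i _ => hmem i
      have hcheb := meas_ge_le_variance_div_sq hSmem (c := -(n * m)) (by nlinarith)
      rw [hvar, hmean] at hcheb
      have hmeas : MeasurableSet
          {z : Fin n → Z | ∑ i, F (z i) ≤ (c + ε) * max 1 (∑ i, D (z i))} :=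
        measurableSet_le (by fun_prop) (by fun_prop)
      have hbad : {z : Fin n → Z | ∑ i, F (z i) ≤ (c + ε) * max 1 (∑ i, D (z i))}ᶜ ⊆
          {z | -(n * m) ≤ |S z - n * m|} := by
        intro z hz
        simp only [Set.mem_compl_iff, Set.mem_ofPred_eq, not_le] at hz ⊢
        have h1 : (c + ε) * ∑ i, D (z i) ≤ (c + ε) * max 1 (∑ i, D (z i)) := by
          gcongr; exact le_max_right _ _
        have h2 : S z = ∑ i, F (z i) - (c + ε) * ∑ i, D (z i) := by
          rw [hSval, hY, Finset.sum_sub_distrib, Finset.mul_sum]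
        exact le_trans (by linarith) (le_abs_self _)
      have hbadle : P.real {z : Fin n → Z | ∑ i, F (z i) ≤ (c + ε) * max 1 (∑ i, D (z i))}ᶜ
          ≤ v / m ^ 2 / n := by
        have : P.real {z : Fin n → Z | ∑ i, F (z i) ≤ (c + ε) * max 1 (∑ i, D (z i))}ᶜ
            ≤ n * v / (-(n * m)) ^ 2 :=
          ENNReal.toReal_le_of_le_ofReal
            (div_nonneg (mul_nonneg hn0.le (variance_nonneg _ _)) (sq_nonneg _))
            ((measure_mono hbad).trans hcheb)
        convert! this using 1
        field_simp
      rw [probReal_compl_eq_one_sub hmeas] at hbadle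
      linarith
    refine tendsto_of_tendsto_of_tendsto_of_le_of_le' (g := fun n : ℕ => 1 - v / m ^ 2 / n)
      (h := fun _ => 1) ?_ tendsto_const_nhds ?_ (Eventually.of_forall fun n => measureReal_le_one)
    · simpa using (tendsto_const_nhds (x := (1 : ℝ))).sub
        (tendsto_const_div_atTop_nhds_zero_nat (v / m ^ 2))
    · filter_upwards [eventually_ge_atTop 1] with n hn using lower n hn

lemma lintegral_pi_prod {ι Z : Type*} [Fintype ι] [MeasurableSpace Z] (μ : Measure Z)
    [IsProbabilityMeasure μ] {f : ι → Z → ENNReal} (hf : ∀ i, Measurable (f i)) :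
    ∫⁻ ω, ∏ i, f i (ω i) ∂(Measure.pi fun _ : ι => μ) = ∏ i, ∫⁻ z, f i z ∂μ := by
  rw [lintegral_prod_eq_prod_lintegral_of_indepFun Finset.univ (fun i (ω : ι → Z) => f i (ω i))
    (iIndepFun_pi fun i => (hf i).aemeasurable) fun i => (hf i).comp (measurable_pi_apply i)]
  exact Finset.prod_congr rfl fun i _ =>
    (measurePreserving_eval (fun _ : ι => μ) i).lintegral_comp (hf i)

lemma isProbabilityMeasure_bern {p : ℝ} (hp : p ∈ Set.Icc (0 : ℝ) 1) :
    IsProbabilityMeasure (bern p) := by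
  constructor
  simp only [bern, Measure.coe_add, Measure.coe_smul, Pi.add_apply, Pi.smul_apply, measure_univ,
    smul_eq_mul, mul_one]
  rw [← ENNReal.ofReal_add hp.1 (by linarith [hp.2])]
  simp

@[fun_prop]
lemma measurable_bern : Measurable bern := by
  refine Measure.measurable_of_measurable_coe _ fun s hs => ?_
  simp only [bern, Measure.coe_add, Measure.coe_smul, Pi.add_apply, Pi.smul_apply, smul_eq_mul]
  fun_prop

/-- The law of `(θ, δ)` when `(θ, x)` has law `J` and `δ` is Bernoulli with parameter `q x`. -/
noncomputable def labelDecision {𝒳 : Type*} [MeasurableSpace 𝒳] (J : Measure (Bool × 𝒳))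
    (q : 𝒳 → ℝ) : Measure (Bool × Bool) :=
  J.bind fun z => (bern (q z.2)).map (Prod.mk z.1)

lemma measurable_map_mk_bern {𝒳 : Type*} [MeasurableSpace 𝒳] {q : 𝒳 → ℝ} (hq : Measurable q) :
    Measurable fun z : Bool × 𝒳 => (bern (q z.2)).map (Prod.mk z.1) := by
  refine measurable_from_prod_countable_right fun b => ?_
  exact (Measure.measurable_map (Prod.mk b) (by fun_prop)).comp (measurable_bern.comp hq)

lemma labelDecision_apply {𝒳 : Type*} [MeasurableSpace 𝒳] (J : Measure (Bool × 𝒳))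
    {q : 𝒳 → ℝ} (hq : Measurable q) (s : Set (Bool × Bool)) :
    labelDecision J q s = ∫⁻ z, bern (q z.2) {b | (z.1, b) ∈ s} ∂J := by
  rw [labelDecision, Measure.bind_apply s.toFinite.measurableSet
    (measurable_map_mk_bern hq).aemeasurable]
  refine lintegral_congr fun z => ?_
  rw [Measure.map_apply (by fun_prop) s.toFinite.measurableSet]
  rfl

lemma isProbabilityMeasure_labelDecision {𝒳 : Type*} [MeasurableSpace 𝒳]
    (J : Measure (Bool × 𝒳)) [IsProbabilityMeasure J]
    {q : 𝒳 → ℝ} (hq : Measurable q) (hq01 : ∀ x, q x ∈ Set.Icc (0 : ℝ) 1) :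
    IsProbabilityMeasure (labelDecision J q) := by
  constructor
  rw [labelDecision_apply J hq]
  have hb := fun x : 𝒳 => isProbabilityMeasure_bern (hq01 x)
  have huniv : ∀ z : Bool × 𝒳, {b | (z.1, b) ∈ (Set.univ : Set (Bool × Bool))} = Set.univ :=
    fun z => Set.eq_univ_of_forall fun b => Set.mem_univ _
  simp only [huniv, measure_univ, lintegral_one]

/-- Independent randomization turns i.i.d. pairs `(θ, x)` into i.i.d. pairs `(θ, δ)`. -/
lemma lintegral_pi_bern {𝒳 : Type*} [MeasurableSpace 𝒳] (J : Measure (Bool × 𝒳))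
    [IsProbabilityMeasure J] {q : 𝒳 → ℝ} (hq : Measurable q)
    (hq01 : ∀ x, q x ∈ Set.Icc (0 : ℝ) 1) (n : ℕ) (E : (Fin n → Bool) → Set (Fin n → Bool)) :
    ∫⁻ ω, (Measure.pi fun i => bern (q (ω i).2)) (E fun i => (ω i).1)
        ∂(Measure.pi fun _ : Fin n => J) =
      (Measure.pi fun _ : Fin n => labelDecision J q)
        {z | (fun i => (z i).2) ∈ E fun i => (z i).1} := by
  have hb := fun x : 𝒳 => isProbabilityMeasure_bern (hq01 x)
  have hl := isProbabilityMeasure_labelDecision J hq hq01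
  have hmap : ∀ z : Bool × 𝒳, IsProbabilityMeasure ((bern (q z.2)).map (Prod.mk z.1)) := fun z =>
    Measure.isProbabilityMeasure_map (by fun_prop)
  have hpi : ∀ ω : Fin n → Bool × 𝒳,
      (Measure.pi fun i => bern (q (ω i).2)).map (fun d i => ((ω i).1, d i)) =
        Measure.pi fun i => (bern (q (ω i).2)).map (Prod.mk (ω i).1) := fun ω =>
    Measure.pi_map_pi (μ := fun i => bern (q (ω i).2)) (f := fun i => Prod.mk (ω i).1)
      fun i => by fun_prop
  have hfac : ∀ s : Set (Bool × Bool),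
      Measurable fun z : Bool × 𝒳 => bern (q z.2) {b | (z.1, b) ∈ s} := by
    refine fun s => measurable_from_prod_countable_right fun b => ?_
    have hs : MeasurableSet {d | (b, d) ∈ s} := (Set.toFinite _).measurableSet
    exact (Measure.measurable_coe hs).comp (measurable_bern.comp hq)
  classical
  set A : Set (Fin n → Bool × Bool) := {z | (fun i => (z i).2) ∈ E fun i => (z i).1} with hA
  have hsingle : ∀ z : Fin n → Bool × Bool,
      (Measure.pi fun _ : Fin n => labelDecision J q) {z} =
        ∫⁻ ω, (∏ i, bern (q (ω i).2) {b | ((ω i).1, b) ∈ ({z i} : Set (Bool × Bool))})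
          ∂(Measure.pi fun _ : Fin n => J) := by
    intro z
    rw [Measure.pi_singleton]
    simp only [labelDecision_apply J hq]
    exact (lintegral_pi_prod J (f := fun i y =>
      bern (q y.2) {b | (y.1, b) ∈ ({z i} : Set (Bool × Bool))}) fun i => hfac {z i}).symm
  rw [← A.coe_toFinset, ← sum_measure_singleton]
  simp only [hsingle]
  have hmeas : ∀ z : Fin n → Bool × Bool, Measurable fun ω : Fin n → Bool × 𝒳 =>
      ∏ i, bern (q (ω i).2) {b | ((ω i).1, b) ∈ ({z i} : Set (Bool × Bool))} := fun z =>
    Finset.measurable_fun_prod _ fun i _ => (hfac {z i}).comp (measurable_pi_apply i)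
  rw [← lintegral_finsetSum _ fun z _ => hmeas z]
  refine lintegral_congr fun ω => ?_
  have hK : ∀ z : Fin n → Bool × Bool,
      ∏ i, bern (q (ω i).2) {b | ((ω i).1, b) ∈ ({z i} : Set (Bool × Bool))} =
        (Measure.pi fun i => (bern (q (ω i).2)).map (Prod.mk (ω i).1)) {z} := by
    intro z
    rw [Measure.pi_singleton]
    refine Finset.prod_congr rfl fun i _ => ?_
    rw [Measure.map_apply (by fun_prop) (measurableSet_singleton _)]
    rfl
  simp only [hK]
  rw [sum_measure_singleton, A.coe_toFinset, ← hpi,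
    Measure.map_apply (by fun_prop) A.toFinite.measurableSet]
  rfl

namespace Model

variable {𝒳 : Type*} [MeasurableSpace 𝒳] (M : Model 𝒳)

/-- The law of an observation under the null. -/
noncomputable def nullLaw : Measure 𝒳 := M.base.withDensity fun x => ENNReal.ofReal (M.f0 x)

/-- The law of an observation under the alternative. -/
noncomputable def altLaw : Measure 𝒳 := M.base.withDensity fun x => ENNReal.ofReal (M.f1 x)

instance : IsProbabilityMeasure M.nullLaw := M.f0_prob

instance : IsProbabilityMeasure M.altLaw := M.f1_prob

lemma π0_pos : 0 < M.π0 := M.π0_mem.1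

lemma π1_pos : 0 < M.π1 := sub_pos.2 M.π0_mem.2

lemma ofReal_π0_add_π1 : ENNReal.ofReal M.π0 + ENNReal.ofReal M.π1 = 1 := by
  rw [← ENNReal.ofReal_add M.π0_pos.le M.π1_pos.le]
  simp [π1]

@[fun_prop]
lemma measurable_f0 : Measurable M.f0 := M.f0_meas

@[fun_prop]
lemma measurable_f1 : Measurable M.f1 := M.f1_meas

@[fun_prop]
lemma measurable_f : Measurable M.f := by
  unfold f
  fun_prop

@[fun_prop]
lemma measurable_Lfdr : Measurable M.Lfdr := by
  unfold Lfdr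
  fun_prop

lemma null_nonneg (x : 𝒳) : 0 ≤ M.π0 * M.f0 x := mul_nonneg M.π0_pos.le (M.f0_nonneg x)

lemma alt_nonneg (x : 𝒳) : 0 ≤ M.π1 * M.f1 x := mul_nonneg M.π1_pos.le (M.f1_nonneg x)

lemma f_nonneg (x : 𝒳) : 0 ≤ M.f x := add_nonneg (M.null_nonneg x) (M.alt_nonneg x)

lemma Lfdr_nonneg (x : 𝒳) : 0 ≤ M.Lfdr x := div_nonneg (M.null_nonneg x) (M.f_nonneg x)

lemma Lfdr_le_one (x : 𝒳) : M.Lfdr x ≤ 1 :=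
  div_le_one_of_le₀ (le_add_of_nonneg_right (M.alt_nonneg x)) (M.f_nonneg x)

lemma f_mul_Lfdr (x : 𝒳) : M.f x * M.Lfdr x = M.π0 * M.f0 x := by
  rcases eq_or_ne (M.f x) 0 with h | h
  · have h' : M.π0 * M.f0 x + M.π1 * M.f1 x = 0 := h
    rw [h, zero_mul]
    linarith [M.null_nonneg x, M.alt_nonneg x]
  · rw [Lfdr, mul_div_cancel₀ _ h]

lemma f_mul_one_sub_Lfdr (x : 𝒳) : M.f x * (1 - M.Lfdr x) = M.π1 * M.f1 x := by
  rw [mul_sub, f_mul_Lfdr, f]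
  ring

lemma Pmix_eq : M.Pmix = ENNReal.ofReal M.π0 • M.nullLaw + ENNReal.ofReal M.π1 • M.altLaw := by
  rw [Pmix, nullLaw, altLaw, ← withDensity_smul _ (by fun_prop), ← withDensity_smul _ (by fun_prop),
    ← withDensity_add_left (by fun_prop)]
  congr 1 with x
  simp only [Pi.add_apply, Pi.smul_apply, smul_eq_mul]
  rw [← ENNReal.ofReal_mul M.π0_pos.le, ← ENNReal.ofReal_mul M.π1_pos.le,
    ← ENNReal.ofReal_add (M.null_nonneg x) (M.alt_nonneg x), f]

instance : IsProbabilityMeasure M.Pmix := by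
  constructor
  simp [Pmix_eq, ofReal_π0_add_π1]

instance : IsProbabilityMeasure M.joint := by
  constructor
  change (ENNReal.ofReal M.π0 • ((Measure.dirac false).prod M.nullLaw) +
    ENNReal.ofReal M.π1 • ((Measure.dirac true).prod M.altLaw)) Set.univ = 1
  simp [ofReal_π0_add_π1]

instance : IsProbabilityMeasure M.νW := Measure.isProbabilityMeasure_map (by fun_prop)

lemma Pmix_withDensity_Lfdr :
    M.Pmix.withDensity (fun x => ENNReal.ofReal (M.Lfdr x)) =
      ENNReal.ofReal M.π0 • M.nullLaw := by
  rw [Pmix, nullLaw, ← withDensity_smul _ (by fun_prop),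
    ← withDensity_mul _ (by fun_prop) (by fun_prop)]
  congr 1 with x
  simp only [Pi.mul_apply, Pi.smul_apply, smul_eq_mul]
  rw [← ENNReal.ofReal_mul (M.f_nonneg x), f_mul_Lfdr, ENNReal.ofReal_mul M.π0_pos.le]

lemma Pmix_withDensity_one_sub_Lfdr :
    M.Pmix.withDensity (fun x => ENNReal.ofReal (1 - M.Lfdr x)) =
      ENNReal.ofReal M.π1 • M.altLaw := by
  rw [Pmix, altLaw, ← withDensity_smul _ (by fun_prop),
    ← withDensity_mul _ (by fun_prop) (by fun_prop)]
  congr 1 with x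
  simp only [Pi.mul_apply, Pi.smul_apply, smul_eq_mul]
  rw [← ENNReal.ofReal_mul (M.f_nonneg x), f_mul_one_sub_Lfdr, ENNReal.ofReal_mul M.π1_pos.le]

lemma lintegral_joint {g : Bool × 𝒳 → ENNReal} (hg : Measurable g) :
    ∫⁻ z, g z ∂M.joint =
      ∫⁻ x, (ENNReal.ofReal (M.Lfdr x) * g (false, x) +
        ENNReal.ofReal (1 - M.Lfdr x) * g (true, x)) ∂M.Pmix := by
  have h0 : Measurable fun x => g (false, x) := hg.comp measurable_prodMk_left
  have h1 : Measurable fun x => g (true, x) := hg.comp measurable_prodMk_left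
  have hj : M.joint = ENNReal.ofReal M.π0 • ((Measure.dirac false).prod M.nullLaw) +
    ENNReal.ofReal M.π1 • ((Measure.dirac true).prod M.altLaw) := rfl
  rw [hj, lintegral_add_measure, lintegral_smul_measure, lintegral_smul_measure,
    Measure.dirac_prod, Measure.dirac_prod, lintegral_map hg measurable_prodMk_left,
    lintegral_map hg measurable_prodMk_left, ← lintegral_smul_measure, ← lintegral_smul_measure,
    ← Pmix_withDensity_Lfdr, ← Pmix_withDensity_one_sub_Lfdr,
    lintegral_withDensity_eq_lintegral_mul _ (by fun_prop) h0,
    lintegral_withDensity_eq_lintegral_mul _ (by fun_prop) h1,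
    ← lintegral_add_left (by fun_prop)]
  rfl

/-- Conditionally on `X`, the label is null with probability `Lfdr X`. -/
lemma integral_joint {g : Bool × 𝒳 → ℝ} (hg : Measurable g) (hg0 : ∀ z, 0 ≤ g z) :
    ∫ z, g z ∂M.joint =
      ∫ x, (M.Lfdr x * g (false, x) + (1 - M.Lfdr x) * g (true, x)) ∂M.Pmix := by
  have h0 : Measurable fun x => g (false, x) := hg.comp measurable_prodMk_left
  have h1 : Measurable fun x => g (true, x) := hg.comp measurable_prodMk_left
  have hW := M.Lfdr_nonneg
  have hW1 := fun x => sub_nonneg.2 (M.Lfdr_le_one x)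
  rw [integral_eq_lintegral_of_nonneg_ae (ae_of_all _ hg0) hg.aestronglyMeasurable,
    integral_eq_lintegral_of_nonneg_ae
      (ae_of_all _ fun x => add_nonneg (mul_nonneg (hW x) (hg0 _)) (mul_nonneg (hW1 x) (hg0 _)))
      (by fun_prop), lintegral_joint M (by fun_prop)]
  congr 1
  refine lintegral_congr fun x => ?_
  rw [ENNReal.ofReal_add (mul_nonneg (hW x) (hg0 _)) (mul_nonneg (hW1 x) (hg0 _)),
    ENNReal.ofReal_mul (hW x), ENNReal.ofReal_mul (hW1 x)]

/-- The rejection probability of the thresholding rule with overall rejection rate `u`. -/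
noncomputable def thresholdRule (u : ℝ) (x : 𝒳) : ℝ :=
  if M.Lfdr x < M.Ginv u then 1 else if M.Lfdr x = M.Ginv u then M.pu u else 0

lemma Gbar_add_atom (t : ℝ) : M.Gbar t + M.atom t = M.G t := by
  have h : Set.Iic t = Set.Iio t ∪ {t} := by
    ext; simp [le_iff_lt_or_eq]
  rw [G, h, measure_union (by simp) (measurableSet_singleton t),
    ENNReal.toReal_add (by finiteness) (by finiteness)]
  rfl

lemma G_eq_cdf (t : ℝ) : M.G t = cdf M.νW t := (cdf_eq_real _ _).symm

lemma G_of_neg {t : ℝ} (ht : t < 0) : M.G t = 0 := by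
  have : M.Lfdr ⁻¹' Set.Iic t = ∅ := by
    ext x
    simpa using ht.trans_le (M.Lfdr_nonneg x)
  rw [G, νW, Measure.map_apply (by fun_prop) measurableSet_Iic, this]
  simp

lemma G_one : M.G 1 = 1 := by
  have : M.Lfdr ⁻¹' Set.Iic 1 = Set.univ := by
    ext x
    simpa using M.Lfdr_le_one x
  rw [G, νW, Measure.map_apply (by fun_prop) measurableSet_Iic, this]
  simp

lemma Gbar_zero : M.Gbar 0 = 0 := by
  have : M.Lfdr ⁻¹' Set.Iio 0 = ∅ := by
    ext x
    simpa using M.Lfdr_nonneg x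
  rw [Gbar, νW, Measure.map_apply (by fun_prop) measurableSet_Iio, this]
  simp

lemma Ginv_zero : M.Ginv 0 = 0 := by
  have : {t | 0 ≤ M.G t} = Set.univ := Set.eq_univ_of_forall fun t => ENNReal.toReal_nonneg
  rw [Ginv, this, Real.sInf_univ]

lemma nonneg_of_le_G {u t : ℝ} (hu : 0 < u) (h : u ≤ M.G t) : 0 ≤ t := by
  by_contra! ht
  rw [M.G_of_neg ht] at h
  linarith

lemma bddBelow_le_G {u : ℝ} (hu : 0 < u) : BddBelow {t | u ≤ M.G t} :=
  ⟨0, fun _ h => M.nonneg_of_le_G hu h⟩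

lemma nonempty_le_G {u : ℝ} (hu : u ≤ 1) : {t | u ≤ M.G t}.Nonempty :=
  ⟨1, by simpa [G_one] using hu⟩

lemma Ginv_mem {u : ℝ} (hu : u ∈ Set.Icc (0 : ℝ) 1) : M.Ginv u ∈ Set.Icc (0 : ℝ) 1 := by
  rcases hu.1.eq_or_lt with rfl | h
  · simp [Ginv_zero]
  · exact ⟨le_csInf (M.nonempty_le_G hu.2) fun t ht => M.nonneg_of_le_G h ht,
      csInf_le (M.bddBelow_le_G h) (by simpa [G_one] using hu.2)⟩

lemma le_G_Ginv {u : ℝ} (hu : u ∈ Set.Icc (0 : ℝ) 1) : u ≤ M.G (M.Ginv u) := by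
  rcases hu.1.eq_or_lt with rfl | h
  · exact ENNReal.toReal_nonneg
  · rw [G_eq_cdf]
    have hc : Tendsto (cdf M.νW) (nhdsWithin (M.Ginv u) (Set.Ioi (M.Ginv u)))
        (nhds (cdf M.νW (M.Ginv u))) :=
      ((cdf M.νW).right_continuous _).mono_left (nhdsWithin_mono _ Set.Ioi_subset_Ici_self)
    refine ge_of_tendsto hc ?_
    filter_upwards [self_mem_nhdsWithin] with s hs
    obtain ⟨r, hr, hrs⟩ := exists_lt_of_csInf_lt (M.nonempty_le_G hu.2) hs
    rw [Set.mem_ofPred_eq, G_eq_cdf] at hr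
    exact hr.trans (monotone_cdf _ hrs.le)

lemma Gbar_Ginv_le {u : ℝ} (hu : u ∈ Set.Icc (0 : ℝ) 1) : M.Gbar (M.Ginv u) ≤ u := by
  rcases hu.1.eq_or_lt with rfl | h
  · simp [Ginv_zero, Gbar_zero]
  · have hG : ∀ s < M.Ginv u, cdf M.νW s ≤ u := fun s hs => by
      rw [← G_eq_cdf]
      by_contra! hlt
      exact (csInf_le (M.bddBelow_le_G h) hlt.le).not_gt hs
    have hlim : Function.leftLim (cdf M.νW) (M.Ginv u) ≤ u :=
      le_of_tendsto ((monotone_cdf M.νW).tendsto_leftLim _)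
        (by filter_upwards [self_mem_nhdsWithin] with s hs using hG s hs)
    have hIio : M.νW (Set.Iio (M.Ginv u)) =
        ENNReal.ofReal (Function.leftLim (cdf M.νW) (M.Ginv u)) := by
      rw [← measure_cdf M.νW, StieltjesFunction.measure_Iio _ (tendsto_cdf_atBot _), sub_zero,
        measure_cdf]
    exact ENNReal.toReal_le_of_le_ofReal hu.1 (hIio.le.trans (ENNReal.ofReal_le_ofReal hlim))

lemma pu_mul_atom {u : ℝ} (hu : u ∈ Set.Icc (0 : ℝ) 1) :
    M.pu u * M.atom (M.Ginv u) = u - M.Gbar (M.Ginv u) := by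
  have h1 := M.le_G_Ginv hu
  have h2 := M.Gbar_Ginv_le hu
  rw [← Gbar_add_atom] at h1
  rcases eq_or_ne (M.atom (M.Ginv u)) 0 with h | h
  · rw [h] at h1 ⊢
    linarith
  · rw [pu, div_mul_cancel₀ _ h]

lemma pu_mem {u : ℝ} (hu : u ∈ Set.Icc (0 : ℝ) 1) : M.pu u ∈ Set.Icc (0 : ℝ) 1 := by
  have h1 := M.le_G_Ginv hu
  have h2 := M.Gbar_Ginv_le hu
  have h3 : 0 ≤ M.atom (M.Ginv u) := ENNReal.toReal_nonneg
  rw [← Gbar_add_atom] at h1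
  exact ⟨div_nonneg (by linarith) h3, div_le_one_of_le₀ (by linarith) h3⟩

lemma thresholdRule_mem {u : ℝ} (hu : u ∈ Set.Icc (0 : ℝ) 1) (x : 𝒳) :
    M.thresholdRule u x ∈ Set.Icc (0 : ℝ) 1 := by
  have := M.pu_mem hu
  unfold thresholdRule
  split_ifs <;> simp_all

@[fun_prop]
lemma measurable_thresholdRule (u : ℝ) : Measurable (M.thresholdRule u) := by
  unfold thresholdRule
  exact Measurable.ite (measurableSet_lt (by fun_prop) (by fun_prop)) (by fun_prop)
    (Measurable.ite (measurableSet_eq_fun (by fun_prop) (by fun_prop)) (by fun_prop) (by fun_prop))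

lemma integrable_of_mem_Icc {g : 𝒳 → ℝ} (hg : Measurable g)
    (hg01 : ∀ x, g x ∈ Set.Icc (0 : ℝ) 1) : Integrable g M.Pmix :=
  Integrable.of_bound hg.aestronglyMeasurable 1
    (ae_of_all _ fun x => by rw [Real.norm_of_nonneg (hg01 x).1]; exact (hg01 x).2)

lemma integral_thresholdRule_mul (u : ℝ) {g : ℝ → ℝ} (hg : Measurable g)
    (hgi : Integrable g M.νW) :
    ∫ x, M.thresholdRule u x * g (M.Lfdr x) ∂M.Pmix =
      (∫ w in Set.Iio (M.Ginv u), g w ∂M.νW) +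
        M.pu u * (g (M.Ginv u) * M.atom (M.Ginv u)) := by
  have h : ∀ w, (if w < M.Ginv u then (1 : ℝ) else if w = M.Ginv u then M.pu u else 0) * g w =
      (Set.Iio (M.Ginv u)).indicator g w +
        M.pu u * ({M.Ginv u} : Set ℝ).indicator (fun _ => g (M.Ginv u)) w := by
    intro w
    by_cases h1 : w < M.Ginv u
    · simp [h1, h1.ne]
    · by_cases h2 : w = M.Ginv u
      · simp [h2]
      · simp [h1, h2]
  have hmap : ∫ w, (if w < M.Ginv u then (1 : ℝ) else if w = M.Ginv u then M.pu u else 0) * g w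
      ∂M.νW = ∫ x, M.thresholdRule u x * g (M.Lfdr x) ∂M.Pmix := by
    rw [νW, integral_map (by fun_prop)]
    · rfl
    · simp only [h]
      exact ((hg.indicator measurableSet_Iio).add ((measurable_const.indicator
        (measurableSet_singleton _)).const_mul _)).aestronglyMeasurable
  rw [← hmap]
  simp only [h]
  rw [integral_add (hgi.indicator measurableSet_Iio)
    (((integrable_const _).indicator (measurableSet_singleton _)).const_mul _),
    integral_indicator measurableSet_Iio, integral_const_mul,
    integral_indicator_const _ (measurableSet_singleton _), smul_eq_mul,
    mul_comm (M.νW.real _)]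
  rfl

lemma integral_thresholdRule {u : ℝ} (hu : u ∈ Set.Icc (0 : ℝ) 1) :
    ∫ x, M.thresholdRule u x ∂M.Pmix = u := by
  have h := M.integral_thresholdRule_mul u (g := fun _ => 1) measurable_const (integrable_const _)
  simp only [mul_one, one_mul, M.pu_mul_atom hu] at h
  rw [h]
  simp [Gbar, measureReal_def]

lemma integral_thresholdRule_mul_Lfdr {u : ℝ} (hu : u ∈ Set.Icc (0 : ℝ) 1) :
    ∫ x, M.thresholdRule u x * M.Lfdr x ∂M.Pmix = M.a u * u := by
  have hid : Integrable (fun w : ℝ => w) M.νW := by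
    rw [νW, integrable_map_measure (by fun_prop) (by fun_prop)]
    exact M.integrable_of_mem_Icc M.measurable_Lfdr fun x => ⟨M.Lfdr_nonneg x, M.Lfdr_le_one x⟩
  rcases eq_or_ne u 0 with rfl | h0
  · have hz : M.thresholdRule 0 =ᵐ[M.Pmix] 0 :=
      (integral_eq_zero_iff_of_nonneg (fun x => (M.thresholdRule_mem hu x).1)
        (M.integrable_of_mem_Icc (by fun_prop) (M.thresholdRule_mem hu))).1
        (M.integral_thresholdRule hu)
    rw [mul_zero]
    refine integral_eq_zero_of_ae ?_
    filter_upwards [hz] with x hx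
    simp [hx]
  · rw [M.integral_thresholdRule_mul u (g := fun w => w) measurable_id hid, a, if_neg h0,
      div_mul_cancel₀ _ h0]

lemma integrable_mul_Lfdr {φ : 𝒳 → ℝ} (hφ : Measurable φ)
    (hφ01 : ∀ x, φ x ∈ Set.Icc (0 : ℝ) 1) : Integrable (fun x => φ x * M.Lfdr x) M.Pmix :=
  M.integrable_of_mem_Icc (by fun_prop) fun x =>
    ⟨mul_nonneg (hφ01 x).1 (M.Lfdr_nonneg x),
      mul_le_one₀ (hφ01 x).2 (M.Lfdr_nonneg x) (M.Lfdr_le_one x)⟩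

/-- Neyman–Pearson lemma: the thresholding rule minimizes the Lagrangian. -/
lemma integral_thresholdRule_mul_Lfdr_add_le {u : ℝ} (hu : u ∈ Set.Icc (0 : ℝ) 1) {φ : 𝒳 → ℝ}
    (hφ : Measurable φ) (hφ01 : ∀ x, φ x ∈ Set.Icc (0 : ℝ) 1) :
    ∫ x, M.thresholdRule u x * M.Lfdr x ∂M.Pmix + M.Ginv u * (∫ x, φ x ∂M.Pmix - u) ≤
      ∫ x, φ x * M.Lfdr x ∂M.Pmix := by
  have hq := M.thresholdRule_mem hu
  have hqm := M.measurable_thresholdRule u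
  have key : 0 ≤ ∫ x, ((φ x * M.Lfdr x - M.thresholdRule u x * M.Lfdr x) -
      M.Ginv u * (φ x - M.thresholdRule u x)) ∂M.Pmix := by
    refine integral_nonneg fun x => ?_
    have h0 := (hφ01 x).1
    have h1 := (hφ01 x).2
    have : 0 ≤ (φ x - M.thresholdRule u x) * (M.Lfdr x - M.Ginv u) := by
      rcases lt_trichotomy (M.Lfdr x) (M.Ginv u) with h | h | h
      · simp only [thresholdRule, if_pos h]
        nlinarith
      · simp [h]
      · simp only [thresholdRule, if_neg h.not_gt, if_neg h.ne']
        nlinarith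
    simp only [Pi.zero_apply]
    linarith
  have hi1 : Integrable (fun x => φ x * M.Lfdr x - M.thresholdRule u x * M.Lfdr x) M.Pmix :=
    (M.integrable_mul_Lfdr hφ hφ01).sub (M.integrable_mul_Lfdr hqm hq)
  have hi2 : Integrable (fun x => M.Ginv u * (φ x - M.thresholdRule u x)) M.Pmix :=
    ((M.integrable_of_mem_Icc hφ hφ01).sub (M.integrable_of_mem_Icc hqm hq)).const_mul _
  rw [integral_sub hi1 hi2,
    integral_sub (M.integrable_mul_Lfdr hφ hφ01) (M.integrable_mul_Lfdr hqm hq),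
    integral_const_mul, integral_sub (M.integrable_of_mem_Icc hφ hφ01)
    (M.integrable_of_mem_Icc hqm hq), M.integral_thresholdRule hu] at key
  linarith

section ustar

variable {α : ℝ}

lemma bddAbove_ustar_set : BddAbove {u | u ∈ Set.Icc (0 : ℝ) 1 ∧ M.a u ≤ α} :=
  ⟨1, fun _ h => h.1.2⟩

lemma zero_mem_ustar_set (hα : 0 ≤ α) : (0 : ℝ) ∈ {u | u ∈ Set.Icc (0 : ℝ) 1 ∧ M.a u ≤ α} :=
  ⟨by simp, by simpa [a] using hα⟩

lemma ustar_mem (hα : 0 ≤ α) : M.ustar α ∈ Set.Icc (0 : ℝ) 1 :=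
  ⟨le_csSup M.bddAbove_ustar_set (M.zero_mem_ustar_set hα),
    csSup_le ⟨0, M.zero_mem_ustar_set hα⟩ fun _ h => h.1.2⟩

lemma a_ustar_mul_le (hα : 0 ≤ α) : M.a (M.ustar α) * M.ustar α ≤ α * M.ustar α := by
  have hu := M.ustar_mem hα
  refine le_of_forall_pos_le_add fun ε hε => ?_
  obtain ⟨v, ⟨hv, hva⟩, hlt⟩ := exists_lt_of_lt_csSup ⟨0, M.zero_mem_ustar_set hα⟩
    (show M.ustar α - ε < sSup {u | u ∈ Set.Icc (0 : ℝ) 1 ∧ M.a u ≤ α} by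
      simpa [ustar] using hε)
  have hvu : v ≤ M.ustar α := le_csSup M.bddAbove_ustar_set ⟨hv, hva⟩
  have h := M.integral_thresholdRule_mul_Lfdr_add_le hu (M.measurable_thresholdRule v)
    (M.thresholdRule_mem hv)
  rw [M.integral_thresholdRule_mul_Lfdr hu, M.integral_thresholdRule_mul_Lfdr hv,
    M.integral_thresholdRule hv] at h
  have ht := M.Ginv_mem hu
  nlinarith [mul_le_mul_of_nonneg_right hva hv.1, mul_le_mul_of_nonneg_left hvu hα,
    mul_le_mul_of_nonneg_right ht.2 (sub_nonneg.2 hvu)]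

lemma integral_le_ustar (hα : 0 ≤ α) {φ : 𝒳 → ℝ} (hφ : Measurable φ)
    (hφ01 : ∀ x, φ x ∈ Set.Icc (0 : ℝ) 1)
    (h : ∫ x, φ x * M.Lfdr x ∂M.Pmix ≤ α * ∫ x, φ x ∂M.Pmix) :
    ∫ x, φ x ∂M.Pmix ≤ M.ustar α := by
  have hm0 : 0 ≤ ∫ x, φ x ∂M.Pmix := integral_nonneg fun x => (hφ01 x).1
  have hm1 : ∫ x, φ x ∂M.Pmix ≤ 1 := by
    calc ∫ x, φ x ∂M.Pmix ≤ ∫ _, (1 : ℝ) ∂M.Pmix :=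
          integral_mono (M.integrable_of_mem_Icc hφ hφ01) (integrable_const _) fun x => (hφ01 x).2
      _ = 1 := by simp
  rcases hm0.eq_or_lt with h0 | hpos
  · rw [← h0]
    exact (M.ustar_mem hα).1
  · refine le_csSup M.bddAbove_ustar_set ⟨⟨hm0, hm1⟩, ?_⟩
    have := M.integral_thresholdRule_mul_Lfdr_add_le ⟨hm0, hm1⟩ hφ hφ01
    rw [M.integral_thresholdRule_mul_Lfdr ⟨hm0, hm1⟩, sub_self, mul_zero, add_zero] at this
    exact le_of_mul_le_mul_right (this.trans h) hpos

lemma integral_one_sub_mul_one_sub_Lfdr {φ : 𝒳 → ℝ} (hφ : Measurable φ)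
    (hφ01 : ∀ x, φ x ∈ Set.Icc (0 : ℝ) 1) :
    ∫ x, (1 - φ x) * (1 - M.Lfdr x) ∂M.Pmix =
      1 - ∫ x, M.Lfdr x ∂M.Pmix - ∫ x, φ x ∂M.Pmix + ∫ x, φ x * M.Lfdr x ∂M.Pmix := by
  have hW : Integrable M.Lfdr M.Pmix :=
    M.integrable_of_mem_Icc M.measurable_Lfdr fun x => ⟨M.Lfdr_nonneg x, M.Lfdr_le_one x⟩
  have hi := M.integrable_of_mem_Icc hφ hφ01
  have h : ∀ x, (1 - φ x) * (1 - M.Lfdr x) = 1 - M.Lfdr x - φ x + φ x * M.Lfdr x := fun x => by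
    ring
  have h1 : Integrable (fun x => 1 - M.Lfdr x) M.Pmix := (integrable_const _).sub hW
  have h2 : Integrable (fun x => 1 - M.Lfdr x - φ x) M.Pmix := h1.sub hi
  simp only [h]
  rw [integral_add h2 (M.integrable_mul_Lfdr hφ hφ01), integral_sub h1 hi,
    integral_sub (integrable_const _) hW]
  simp

lemma integral_acceptance_thresholdRule_le {u : ℝ} (hu : u ∈ Set.Icc (0 : ℝ) 1) :
    ∫ x, (1 - M.thresholdRule u x) * (1 - M.Lfdr x) ∂M.Pmix ≤ (1 - M.Ginv u) * (1 - u) := by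
  have hq := M.thresholdRule_mem hu
  have hqm := M.measurable_thresholdRule u
  calc ∫ x, (1 - M.thresholdRule u x) * (1 - M.Lfdr x) ∂M.Pmix
      ≤ ∫ x, (1 - M.Ginv u) * (1 - M.thresholdRule u x) ∂M.Pmix := by
        refine integral_mono (M.integrable_of_mem_Icc (by fun_prop) fun x => ?_)
          (((integrable_const _).sub (M.integrable_of_mem_Icc hqm hq)).const_mul _) fun x => ?_
        · have h1 := (hq x).1
          have h2 := (hq x).2
          have h3 := M.Lfdr_nonneg x
          have h4 := M.Lfdr_le_one x
          exact ⟨mul_nonneg (by linarith) (by linarith),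
            mul_le_one₀ (by linarith) (by linarith) (by linarith)⟩
        · rcases lt_or_ge (M.Lfdr x) (M.Ginv u) with h | h
          · simp [thresholdRule, h]
          · dsimp only
            rw [mul_comm]
            exact mul_le_mul_of_nonneg_right (by linarith) (by linarith [(hq x).2])
    _ = (1 - M.Ginv u) * (1 - u) := by
        rw [integral_const_mul, integral_sub (integrable_const _) (M.integrable_of_mem_Icc hqm hq),
          M.integral_thresholdRule hu]
        simp

/-- Among rules whose rejections have null proportion at most `α`, the thresholding rule at
`u*(α)` has the smallest proportion of non-nulls among its acceptances. -/
lemma thresholdRule_ustar_le (hα : 0 ≤ α) (hlt : M.ustar α < 1) {φ : 𝒳 → ℝ} (hφ : Measurable φ)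
    (hφ01 : ∀ x, φ x ∈ Set.Icc (0 : ℝ) 1)
    (h : ∫ x, φ x * M.Lfdr x ∂M.Pmix ≤ α * ∫ x, φ x ∂M.Pmix) :
    (∫ x, (1 - M.thresholdRule (M.ustar α) x) * (1 - M.Lfdr x) ∂M.Pmix) / (1 - M.ustar α) ≤
      (∫ x, (1 - φ x) * (1 - M.Lfdr x) ∂M.Pmix) / (1 - ∫ x, φ x ∂M.Pmix) := by
  have hu := M.ustar_mem hα
  have hm := M.integral_le_ustar hα hφ hφ01 h
  have hB := M.integral_acceptance_thresholdRule_le hu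
  have hN := M.integral_thresholdRule_mul_Lfdr_add_le hu hφ hφ01
  have hBeq := M.integral_one_sub_mul_one_sub_Lfdr (M.measurable_thresholdRule (M.ustar α))
    (M.thresholdRule_mem hu)
  rw [M.integral_thresholdRule hu] at hBeq
  rw [div_le_div_iff₀ (by linarith) (by linarith), M.integral_one_sub_mul_one_sub_Lfdr hφ hφ01]
  set B := ∫ x, (1 - M.thresholdRule (M.ustar α) x) * (1 - M.Lfdr x) ∂M.Pmix
  nlinarith [mul_le_mul_of_nonneg_right hB (sub_nonneg.2 hm),
    mul_le_mul_of_nonneg_right hN (sub_nonneg.2 hlt.le)]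

end ustar

/-- For a single hypothesis, the criteria of a rule only depend on its rejection probability. -/
lemma exists_rejection_probability {κ : (Fin 1 → 𝒳) → Measure (Fin 1 → Bool)} (hκ : IsRule κ) :
    ∃ φ : 𝒳 → ℝ, Measurable φ ∧ (∀ x, φ x ∈ Set.Icc (0 : ℝ) 1) ∧
      M.mFDR 1 κ = (∫ x, φ x * M.Lfdr x ∂M.Pmix) / ∫ x, φ x ∂M.Pmix ∧
      M.mFNR 1 κ = (∫ x, (1 - φ x) * (1 - M.Lfdr x) ∂M.Pmix) / (1 - ∫ x, φ x ∂M.Pmix) := by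
  have hprob := hκ.2
  set s : Set (Fin 1 → Bool) := {d | d 0 = true} with hs
  have hsm : MeasurableSet s := s.toFinite.measurableSet
  set φ : 𝒳 → ℝ := fun x => (κ fun _ => x).real s with hφ
  have hφm : Measurable φ :=
    ((Measure.measurable_coe hsm).comp (hκ.1.comp (by fun_prop))).ennreal_toReal
  have hφ01 : ∀ x, φ x ∈ Set.Icc (0 : ℝ) 1 := fun x => ⟨measureReal_nonneg, measureReal_le_one⟩
  have hpt : ∀ ω : Fin 1 → Bool × 𝒳, (fun i => (ω i).2) = fun _ => (ω 0).2 := fun ω => by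
    funext i
    rw [Subsingleton.elim i 0]
  have hind : ∀ d : Fin 1 → Bool, (if d 0 then (1 : ℝ) else 0) = s.indicator 1 d := fun d => by
    simp [hs, Set.indicator_apply]
  have hind' : ∀ d : Fin 1 → Bool, (if d 0 then (0 : ℝ) else 1) = sᶜ.indicator 1 d := fun d => by
    by_cases h : d 0 <;> simp [hs, h]
  have hcompl : ∀ x, (κ fun _ => x).real sᶜ = 1 - φ x := fun x => probReal_compl_eq_one_sub hsm
  have hRej : ∀ ω : Fin 1 → Bool × 𝒳, ∫ d, nRej d ∂(κ fun i => (ω i).2) = φ (ω 0).2 := fun ω => by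
    simp only [nRej, Fin.sum_univ_one, hind, hpt]
    exact integral_indicator_one hsm
  have hAcc : ∀ ω : Fin 1 → Bool × 𝒳, ∫ d, nAcc d ∂(κ fun i => (ω i).2) = 1 - φ (ω 0).2 :=
    fun ω => by
      simp only [nAcc, Fin.sum_univ_one, hind', hpt]
      rw [integral_indicator_one hsm.compl, hcompl]
  have hFD : ∀ ω : Fin 1 → Bool × 𝒳, ∫ d, nFD (fun i => (ω i).1) d ∂(κ fun i => (ω i).2) =
      φ (ω 0).2 * (if (ω 0).1 then 0 else 1) := fun ω => by
    simp only [nFD, Fin.sum_univ_one, hind, hpt]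
    rw [integral_mul_const, integral_indicator_one hsm]
  have hFN : ∀ ω : Fin 1 → Bool × 𝒳, ∫ d, nFN (fun i => (ω i).1) d ∂(κ fun i => (ω i).2) =
      (1 - φ (ω 0).2) * (if (ω 0).1 then 1 else 0) := fun ω => by
    simp only [nFN, Fin.sum_univ_one, hind', hpt]
    rw [integral_mul_const, integral_indicator_one hsm.compl, hcompl]
  have heval : ∀ {g : Bool × 𝒳 → ℝ}, Measurable g → (∀ z, 0 ≤ g z) →
      ∫ ω, g (ω 0) ∂(M.jointN 1) =
        ∫ x, (M.Lfdr x * g (false, x) + (1 - M.Lfdr x) * g (true, x)) ∂M.Pmix := by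
    intro g hg hg0
    rw [← M.integral_joint hg hg0]
    exact integral_comp_eval (μ := fun _ : Fin 1 => M.joint) hg.aestronglyMeasurable
  have hφz : Measurable fun z : Bool × 𝒳 => φ z.2 := by fun_prop
  have hlab : ∀ a b : ℝ, Measurable fun z : Bool × 𝒳 => if z.1 then a else b := fun a b =>
    (measurable_of_finite fun t : Bool => if t then a else b).comp measurable_fst
  refine ⟨φ, hφm, hφ01, ?_, ?_⟩
  · simp only [mFDR, hFD, hRej]
    rw [heval (g := fun z => φ z.2 * if z.1 then 0 else 1) (hφz.mul (hlab 0 1))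
        fun z => mul_nonneg (hφ01 _).1 (by split_ifs <;> norm_num),
      heval (g := fun z => φ z.2) hφz fun z => (hφ01 _).1]
    congr 1 <;> refine integral_congr_ae (ae_of_all _ fun x => ?_)
    · simp [mul_comm]
    · dsimp only; ring
  · simp only [mFNR, hFN, hAcc]
    rw [heval (g := fun z => (1 - φ z.2) * if z.1 then 1 else 0)
        ((measurable_const.sub hφz).mul (hlab 1 0))
        fun z => mul_nonneg (sub_nonneg.2 (hφ01 _).2) (by split_ifs <;> norm_num),
      heval (g := fun z => 1 - φ z.2) (measurable_const.sub hφz)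
        fun z => sub_nonneg.2 (hφ01 _).2]
    have h1 : ∫ x, (1 - φ x) ∂M.Pmix = 1 - ∫ x, φ x ∂M.Pmix := by
      rw [integral_sub (integrable_const _) (M.integrable_of_mem_Icc hφm hφ01)]
      simp
    rw [← h1]
    congr 1 <;> refine integral_congr_ae (ae_of_all _ fun x => ?_)
    · simp [mul_comm]
    · dsimp only; ring

/-- The Neyman–Pearson rule attains `mFNR*(α)`. -/
lemma integral_acceptance_le_mFNRstar_mul {α : ℝ} (hα : 0 ≤ α) :
    ∫ x, (1 - M.thresholdRule (M.ustar α) x) * (1 - M.Lfdr x) ∂M.Pmix ≤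
      M.mFNRstar α * (1 - M.ustar α) := by
  have hu := M.ustar_mem hα
  rcases hu.2.eq_or_lt with h1 | hlt
  · have := M.integral_acceptance_thresholdRule_le hu
    rw [h1] at this ⊢
    simpa using this
  · rw [← div_le_iff₀ (by linarith)]
    refine le_csInf ?_ ?_
    · refine ⟨_, fun _ => Measure.dirac fun _ => false, ⟨measurable_const, fun _ => inferInstance⟩,
        ?_, rfl⟩
      simpa [mFDR, nFD, nRej] using hα
    · rintro r ⟨κ, hκ, hle, rfl⟩
      obtain ⟨φ, hφ, hφ01, hFDR, hFNR⟩ := M.exists_rejection_probability hκ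
      rw [hFNR]
      refine M.thresholdRule_ustar_le hα hlt hφ hφ01 ?_
      have hi := M.integrable_of_mem_Icc hφ hφ01
      rcases (integral_nonneg fun x => (hφ01 x).1 : 0 ≤ ∫ x, φ x ∂M.Pmix).eq_or_lt with h0 | hpos
      · rw [← h0, mul_zero, h0]
        exact integral_mono (M.integrable_mul_Lfdr hφ hφ01) hi fun x =>
          mul_le_of_le_one_right (hφ01 x).1 (M.Lfdr_le_one x)
      · rwa [hFDR, div_le_iff₀ hpos] at hle

lemma labelDecision_joint_real {q : 𝒳 → ℝ} (hq : Measurable q)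
    (hq01 : ∀ x, q x ∈ Set.Icc (0 : ℝ) 1) (θ d : Bool) :
    (labelDecision M.joint q).real {(θ, d)} =
      ∫ x, (if d then q x else 1 - q x) * (if θ then 1 - M.Lfdr x else M.Lfdr x) ∂M.Pmix := by
  have hqd : ∀ x, 0 ≤ if d then q x else 1 - q x := fun x => by
    split_ifs
    exacts [(hq01 x).1, sub_nonneg.2 (hq01 x).2]
  have hqm : Measurable fun x => if d then q x else 1 - q x := by
    cases d <;> simp <;> fun_prop
  have hbern : ∀ z : Bool × 𝒳, bern (q z.2) {b | (z.1, b) ∈ ({(θ, d)} : Set (Bool × Bool))} =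
      ENNReal.ofReal ((if z.1 = θ then 1 else 0) * if d then q z.2 else 1 - q z.2) := by
    rintro ⟨t, x⟩
    by_cases h : t = θ
    · cases d <;> simp [bern, h]
    · simp [h]
  have hg : Measurable fun z : Bool × 𝒳 =>
      (if z.1 = θ then (1 : ℝ) else 0) * if d then q z.2 else 1 - q z.2 :=
    ((measurable_of_finite fun t : Bool => if t = θ then (1 : ℝ) else 0).comp measurable_fst).mul
      (hqm.comp measurable_snd)
  have hg0 : ∀ z : Bool × 𝒳, 0 ≤ (if z.1 = θ then (1 : ℝ) else 0) *
      if d then q z.2 else 1 - q z.2 := fun z =>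
    mul_nonneg (by split_ifs <;> norm_num) (hqd z.2)
  rw [measureReal_def, labelDecision_apply _ hq]
  simp only [hbern]
  rw [← integral_eq_lintegral_of_nonneg_ae (ae_of_all _ hg0) hg.aestronglyMeasurable,
    M.integral_joint hg hg0]
  refine integral_congr_ae (ae_of_all _ fun x => ?_)
  cases θ <;> simp [mul_comm]

end Model

/-- **Optimal FDP control with high probability** (Theorem 2, achievability part). If
`β ≥ mFNR*(α)`, then for every `ε > 0` the Neyman–Pearson rule `δ^n_NP(α)` satisfies
`P(FDP ≤ α + ε) → 1` and `P(FNP ≤ β + ε) → 1` as `n → ∞`. -/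
theorem NP_high_prob_control {𝒳 : Type*} [MeasurableSpace 𝒳] (M : Model 𝒳)
    (α β : ℝ) (hα : α ∈ Set.Icc (0 : ℝ) 1) (hβ : β ∈ Set.Icc (0 : ℝ) 1)
    (hβge : M.mFNRstar α ≤ β) :
    ∀ ε > (0 : ℝ),
      Filter.Tendsto
        (fun n => M.prob n (M.NP α n) fun θ => {d | FDP θ d ≤ α + ε})
        Filter.atTop (nhds 1) ∧
      Filter.Tendsto
        (fun n => M.prob n (M.NP α n) fun θ => {d | FNP θ d ≤ β + ε})
        Filter.atTop (nhds 1) := by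
  intro ε hε
  have hu := M.ustar_mem hα.1
  set q := M.thresholdRule (M.ustar α) with hqdef
  have hq : Measurable q := M.measurable_thresholdRule _
  have hq01 : ∀ x, q x ∈ Set.Icc (0 : ℝ) 1 := M.thresholdRule_mem hu
  have hqi := M.integrable_of_mem_Icc hq hq01
  have hqW := M.integrable_mul_Lfdr hq hq01
  have hWi : Integrable M.Lfdr M.Pmix :=
    M.integrable_of_mem_Icc M.measurable_Lfdr fun x => ⟨M.Lfdr_nonneg x, M.Lfdr_le_one x⟩
  have hprob := isProbabilityMeasure_labelDecision M.joint hq hq01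
  have hlaw : ∀ (n : ℕ) (E : (Fin n → Bool) → Set (Fin n → Bool)), M.prob n (M.NP α n) E =
      (Measure.pi fun _ : Fin n => labelDecision M.joint q).real
        {z | (fun i => (z i).2) ∈ E fun i => (z i).1} := fun n E =>
    congrArg ENNReal.toReal (lintegral_pi_bern M.joint hq hq01 n E)
  have hint : ∀ g : Bool × Bool → ℝ, ∫ z, g z ∂(labelDecision M.joint q) =
      g (true, true) * (∫ x, q x * (1 - M.Lfdr x) ∂M.Pmix) +
      g (true, false) * (∫ x, (1 - q x) * (1 - M.Lfdr x) ∂M.Pmix) +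
      g (false, true) * (∫ x, q x * M.Lfdr x ∂M.Pmix) +
      g (false, false) * (∫ x, (1 - q x) * M.Lfdr x ∂M.Pmix) := fun g => by
    rw [integral_fintype (Integrable.of_finite)]
    simp [Fintype.sum_prod_type, M.labelDecision_joint_real hq hq01]
    ring
  have h11 : ∫ x, q x * (1 - M.Lfdr x) ∂M.Pmix =
      M.ustar α - ∫ x, q x * M.Lfdr x ∂M.Pmix := by
    simp only [mul_sub, mul_one]
    rw [integral_sub hqi hqW, M.integral_thresholdRule hu]
  have h00 : ∫ x, (1 - q x) * M.Lfdr x ∂M.Pmix =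
      ∫ x, M.Lfdr x ∂M.Pmix - ∫ x, q x * M.Lfdr x ∂M.Pmix := by
    simp only [sub_mul, one_mul]
    rw [integral_sub hWi hqW]
  have h10 := M.integral_one_sub_mul_one_sub_Lfdr hq hq01
  rw [M.integral_thresholdRule hu] at h10
  simp only [hlaw]
  constructor
  · have h := tendsto_pi_sum_le (labelDecision M.joint q) (c := α) (ε := ε)
      (F := fun z => (if z.2 then (1 : ℝ) else 0) * (if z.1 then (0 : ℝ) else 1))
      (D := fun z => if z.2 then (1 : ℝ) else 0) (measurable_of_finite _) (measurable_of_finite _)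
      (by simp) (by simp) (by simp) hα.1 hε (by
        simp only [hint]
        have := M.a_ustar_mul_le hα.1
        rw [← M.integral_thresholdRule_mul_Lfdr hu] at this
        simp only [h11]
        simp
        linarith)
    refine h.congr fun n => congrArg _ (Set.ext fun z => ?_)
    simp only [Set.mem_ofPred_eq, FDP, nFD, nRej]
    rw [div_le_iff₀ (by positivity)]
  · have h := tendsto_pi_sum_le (labelDecision M.joint q) (c := β) (ε := ε)
      (F := fun z => (if z.2 then (0 : ℝ) else 1) * (if z.1 then (1 : ℝ) else 0))
      (D := fun z => if z.2 then (0 : ℝ) else 1) (measurable_of_finite _) (measurable_of_finite _)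
      (by simp) (by simp) (by simp) hβ.1 hε (by
        have hstar := M.integral_acceptance_le_mFNRstar_mul hα.1
        have hle := mul_le_mul_of_nonneg_right hβge (sub_nonneg.2 hu.2)
        simp only [hint]
        simp only [Bool.false_eq_true, if_true, if_false, mul_one, mul_zero, one_mul, zero_mul,
          add_zero, zero_add]
        have hD : (∫ x, (1 - q x) * (1 - M.Lfdr x) ∂M.Pmix) + ∫ x, (1 - q x) * M.Lfdr x ∂M.Pmix =
            1 - M.ustar α := by linarith
        rw [hD]
        exact hstar.trans hle)
    refine h.congr fun n => congrArg _ (Set.ext fun z => ?_)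
    simp only [Set.mem_ofPred_eq, FNP, nFN, nAcc]
    rw [div_le_iff₀ (by positivity)]

end TwoGroup
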